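/- Let α > 0 be a noninteger real number, n = ⌊α⌋ + 1, b ∈ ℤ, f : ℤ → ℝ, and t ∈ ℤ with t ≤ b − 1. Then the nabla right Caputo and Riemann fractional differences are related by (^C_b∇^{α} f)(t) = (_b∇^{α} f)(t) − Σ_{k=0}^{n−1} [Γ(b−t+k−α)/(Γ(b−t)·Γ(k−α+1))]·((−Δ)^k f)(b), where (−Δ)^k denotes the k-fold iterate of the operator f ↦ −Δf. -/

import Mathlib

/-- Backward difference operator: `(∇ f)(t) = f t − f (t−1)`. -/
def nablaOp (f : ℤ → ℝ) : ℤ → ℝ := fun t => f t - f (t - 1)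

/-- Forward difference operator: `(Δ f)(t) = f (t+1) − f t`. -/
def deltaOp (f : ℤ → ℝ) : ℤ → ℝ := fun t => f (t + 1) - f t

/-- The operator `−Δ`. -/
def negDeltaOp (f : ℤ → ℝ) : ℤ → ℝ := fun t => -(f (t + 1) - f t)

/-- Nabla left fractional sum of order `α` starting at `a`:
`(∇_a^{-α} f)(t) = (1/Γ(α)) Σ_{s=a+1}^{t} [Γ(t−s+α)/Γ(t−s+1)] f(s)`. -/
noncomputable def nablaLeftSum (a : ℤ) (α : ℝ) (f : ℤ → ℝ) : ℤ → ℝ := fun t =>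
  (1 / Real.Gamma α) * ∑ s ∈ Finset.Icc (a + 1) t,
    (Real.Gamma ((t : ℝ) - (s : ℝ) + α) / Real.Gamma ((t : ℝ) - (s : ℝ) + 1)) * f s

/-- Nabla right fractional sum of order `α` ending at `b`:
`(_b∇^{-α} f)(t) = (1/Γ(α)) Σ_{s=t}^{b−1} [Γ(s−t+α)/Γ(s−t+1)] f(s)`. -/
noncomputable def nablaRightSum (b : ℤ) (α : ℝ) (f : ℤ → ℝ) : ℤ → ℝ := fun t =>
  (1 / Real.Gamma α) * ∑ s ∈ Finset.Icc t (b - 1),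
    (Real.Gamma ((s : ℝ) - (t : ℝ) + α) / Real.Gamma ((s : ℝ) - (t : ℝ) + 1)) * f s

theorem negDeltaOp_iterate (f : ℤ → ℝ) (n : ℕ) :
    negDeltaOp^[n] f = fun t => (-1 : ℝ) ^ n * deltaOp^[n] f t := by
  induction n with
  | zero => simp
  | succ n ih =>
    rw [Function.iterate_succ_apply', ih, Function.iterate_succ_apply']
    funext t
    simp only [negDeltaOp, deltaOp]
    ring

theorem Real.inv_Gamma_eq_mul_inv_Gamma_add_one (s : ℝ) :
    (Real.Gamma s)⁻¹ = s * (Real.Gamma (s + 1))⁻¹ := by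
  rcases eq_or_ne s 0 with rfl | hs
  · simp
  · rw [Real.Gamma_add_one hs, mul_inv, mul_inv_cancel_left₀ hs]

/-- The kernel `Γ(b−t−1+μ) / (Γ(b−t) Γ(μ))` of the fractional sum of order `μ` at the last point
`b − 1` of the summation range. -/
noncomputable def boundaryKernel (b : ℤ) (μ : ℝ) : ℤ → ℝ := fun t =>
  Real.Gamma ((b : ℝ) - (t : ℝ) - 1 + μ) * (Real.Gamma ((b : ℝ) - (t : ℝ)))⁻¹ *
    (Real.Gamma μ)⁻¹

theorem boundaryKernel_of_le {b t : ℤ} (μ : ℝ) (h : b ≤ t) : boundaryKernel b μ t = 0 := by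
  have h0 : Real.Gamma ((b : ℝ) - (t : ℝ)) = 0 := by
    rw [Real.Gamma_eq_zero_iff]
    refine ⟨(t - b).toNat, ?_⟩
    have : (((t - b).toNat : ℤ) : ℝ) = ((t - b : ℤ) : ℝ) := by
      rw [Int.toNat_of_nonneg (by omega)]
    push_cast at this
    rw [this]
    ring
  simp [boundaryKernel, h0]

theorem negDeltaOp_boundaryKernel (b : ℤ) {μ : ℝ} (hμ : ∀ m : ℤ, μ ≠ (m : ℝ)) :
    negDeltaOp (boundaryKernel b μ) = boundaryKernel b (μ - 1) := by
  funext t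
  have h1 : (b : ℝ) - t - 2 + μ ≠ 0 := fun h => hμ (2 + t - b) (by push_cast; linarith)
  have hG := Real.Gamma_add_one h1
  have hb := Real.inv_Gamma_eq_mul_inv_Gamma_add_one ((b : ℝ) - t - 1)
  have hm := Real.inv_Gamma_eq_mul_inv_Gamma_add_one (μ - 1)
  simp only [negDeltaOp, boundaryKernel]
  push_cast
  rw [show (b : ℝ) - (t + 1) - 1 + μ = b - t - 2 + μ by ring,
    show (b : ℝ) - (t + 1) = b - t - 1 by ring,
    show (b : ℝ) - t - 1 + μ = b - t - 2 + μ + 1 by ring,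
    show (b : ℝ) - t - 1 + (μ - 1) = b - t - 2 + μ by ring, hG, hb, hm,
    sub_add_cancel, sub_add_cancel]
  ring

theorem nablaRightSum_of_le {b t : ℤ} (ν : ℝ) (f : ℤ → ℝ) (h : b ≤ t) :
    nablaRightSum b ν f t = 0 := by
  simp [nablaRightSum, Finset.Icc_eq_empty_of_lt (show b - 1 < t by omega)]

theorem nablaRightSum_eq_sum_range (ν : ℝ) (f : ℤ → ℝ) (t : ℤ) (N : ℕ) :
    nablaRightSum (t + N) ν f t = (1 / Real.Gamma ν) * ∑ m ∈ Finset.range N,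
      (Real.Gamma ((m : ℝ) + ν) / Real.Gamma ((m : ℝ) + 1)) * f (t + m) := by
  unfold nablaRightSum
  congr 1
  symm
  refine Finset.sum_bij (fun m _ => t + (m : ℤ)) ?_ ?_ ?_ ?_
  · intro m hm
    simp only [Finset.mem_range, Finset.mem_Icc] at hm ⊢
    omega
  · intro m _ m' _ h
    simpa using h
  · intro s hs
    simp only [Finset.mem_Icc] at hs
    exact ⟨(s - t).toNat, by simp only [Finset.mem_range]; omega, by omega⟩
  · intro m _
    simp

theorem nablaRightSum_negDeltaOp (b : ℤ) (ν : ℝ) (f : ℤ → ℝ) (t : ℤ) :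
    nablaRightSum b ν (negDeltaOp f) t =
      negDeltaOp (nablaRightSum b ν f) t - boundaryKernel b ν t * f b := by
  rcases le_or_gt b t with h | h
  · simp [negDeltaOp, nablaRightSum_of_le _ _ h, nablaRightSum_of_le _ _ (show b ≤ t + 1 by omega),
      boundaryKernel_of_le _ h]
  · obtain ⟨N, rfl⟩ : ∃ N : ℕ, b = t + 1 + N := ⟨(b - t - 1).toNat, by omega⟩
    have e : nablaRightSum (t + 1 + N) ν f t = nablaRightSum (t + (N + 1 : ℕ)) ν f t := by
      congr 1
      push_cast
      ring
    have e' : nablaRightSum (t + 1 + N) ν (negDeltaOp f) t =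
        nablaRightSum (t + (N + 1 : ℕ)) ν (negDeltaOp f) t := by
      congr 1
      push_cast
      ring
    rw [e', nablaRightSum_eq_sum_range]
    simp only [negDeltaOp]
    rw [e, nablaRightSum_eq_sum_range, nablaRightSum_eq_sum_range]
    simp only [mul_neg, mul_sub, Finset.sum_neg_distrib, Finset.sum_sub_distrib]
    rw [Finset.sum_range_succ (fun m : ℕ => _ * f (t + m + 1))]
    simp only [boundaryKernel, show ∀ m : ℕ, t + 1 + (m : ℤ) = t + m + 1 from fun m => by ring]
    push_cast
    rw [show (t : ℝ) + N + 1 - t - 1 + ν = N + ν by ring,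
      show (t : ℝ) + N + 1 - t = N + 1 by ring]
    ring

theorem nablaRightSum_negDeltaOp_iterate (b : ℤ) {ν : ℝ} (hν : ∀ m : ℤ, ν ≠ (m : ℝ))
    (f : ℤ → ℝ) (n : ℕ) (t : ℤ) :
    nablaRightSum b ν (negDeltaOp^[n] f) t =
      negDeltaOp^[n] (nablaRightSum b ν f) t -
        ∑ k ∈ Finset.range n,
          boundaryKernel b (ν - n + k + 1) t * (negDeltaOp^[k] f) b := by
  induction n generalizing t with
  | zero => simp
  | succ n ih =>
    have hk (k : ℕ) : boundaryKernel b (ν - (n + 1 : ℕ) + k + 1) t =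
        negDeltaOp (boundaryKernel b (ν - n + k + 1)) t := by
      rw [negDeltaOp_boundaryKernel b fun m h => hν (m + n - k - 1) (by push_cast; linarith)]
      congr 1
      push_cast
      ring
    rw [Function.iterate_succ_apply', nablaRightSum_negDeltaOp, Finset.sum_range_succ,
      Function.iterate_succ_apply']
    rw [show ν - ((n + 1 : ℕ) : ℝ) + n + 1 = ν by push_cast; ring]
    simp only [hk]
    simp only [negDeltaOp, ih, neg_mul, sub_mul, Finset.sum_neg_distrib, Finset.sum_sub_distrib]
    ring

theorem stmt10 (α : ℝ) (hα : 0 < α) (hαni : ∀ m : ℤ, α ≠ (m : ℝ)) (n : ℕ)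
    (hn : (n : ℤ) = ⌊α⌋ + 1) (b : ℤ) (f : ℤ → ℝ) (t : ℤ) (ht : t ≤ b - 1) :
    nablaRightSum b ((n : ℝ) - α) (fun s => (-1 : ℝ) ^ n * deltaOp^[n] f s) t =
      (-1 : ℝ) ^ n * deltaOp^[n] (nablaRightSum b ((n : ℝ) - α) f) t -
        ∑ k ∈ Finset.range n,
          (Real.Gamma ((b : ℝ) - (t : ℝ) + (k : ℝ) - α) /
            (Real.Gamma ((b : ℝ) - (t : ℝ)) * Real.Gamma ((k : ℝ) - α + 1))) *
              (negDeltaOp^[k] f) b := by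
  have hν : ∀ m : ℤ, (n : ℝ) - α ≠ (m : ℝ) := fun m h =>
    hαni (n - m) (by push_cast; linarith)
  have key := nablaRightSum_negDeltaOp_iterate b hν f n t
  rw [negDeltaOp_iterate f n, negDeltaOp_iterate (nablaRightSum b (n - α) f) n] at key
  rw [key]
  congr 1
  refine Finset.sum_congr rfl fun k _ => ?_
  rw [boundaryKernel, show (n : ℝ) - α - n + k + 1 = k - α + 1 by ring,
    show (b : ℝ) - t - 1 + (k - α + 1) = b - t + k - α by ring, div_eq_mul_inv, mul_inv,
    ← mul_assoc (Real.Gamma _)]
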